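/- arXiv:0711.3493 — 2 statements merged into one kernel-verified Lean document; each statement's English description precedes it below -/
import Mathlib

section
/- Let r ≥ 2 be an integer, 0 < c ≤ 1/2 real, H a graph of order r, and G a graph of order n ≥ 2. If G contains more than c·n^r (not necessarily induced) copies of H, then G contains a subgraph isomorphic to the blow-up H(s, ..., s, t), where s = ⌊c^{r²} ln n⌋ and t > n^{1 − c^{r-1}}. -/
open Finset in
/-- A bipartite relation in which each of `B * s` vertices has more than `2 * |V| / B` neighbours
contains a complete bipartite piece with `s` vertices on one side and at least `|V| / B ^ s`
on the other. -/
theorem exists_embedding_large_common_neighbors {V : Type*} [Fintype V] [Nonempty V]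
    (B s : ℕ) (hs : 1 ≤ s) (R : Fin (B * s) → V → Prop)
    [∀ i, DecidablePred (R i)]
    (hR : ∀ i, 2 * Fintype.card V ≤ B * #{v | R i v}) (hB : 1 ≤ B) :
    ∃ e : Fin s ↪ Fin (B * s),
      Fintype.card V ≤ #{v | ∀ i, R (e i) v} * B ^ s := by
  classical
  by_contra! hcon
  set n := Fintype.card V with hn
  have hn0 : 0 < n := Fintype.card_pos
  let d : V → ℕ := fun v => #{i | R i v}
  have hsum : 2 * s * n ≤ ∑ v, d v := by
    have h1 : ∑ v, d v = ∑ i, #{v | R i v} := by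
      simp only [d, card_filter]
      exact sum_comm
    have h2 : ∑ _i : Fin (B * s), 2 * n ≤ ∑ i, B * #{v | R i v} := sum_le_sum fun i _ => hR i
    rw [← mul_sum univ (fun i => #{v | R i v}), ← h1] at h2
    simp only [sum_const, card_univ, Fintype.card_fin, smul_eq_mul] at h2
    refine Nat.le_of_mul_le_mul_left ?_ hB
    linarith
  have hsum' : s * n ≤ ∑ v, (d v - s) := by
    have : ∑ v, d v ≤ ∑ v, ((d v - s) + s) := sum_le_sum fun v _ => by omega
    rw [sum_add_distrib] at this
    simp only [sum_const, card_univ, smul_eq_mul, ← hn] at this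
    nlinarith
  have hpow : s ^ s * n ≤ ∑ v, (d v - s) ^ s := by
    obtain ⟨k, rfl⟩ : ∃ k, s = k + 1 := ⟨s - 1, by omega⟩
    have h := pow_sum_le_card_mul_sum_pow (s := univ) (f := fun v => d v - (k + 1))
      (fun _ _ => Nat.zero_le _) k
    rw [card_univ, ← hn] at h
    refine Nat.le_of_mul_le_mul_left ?_ (Nat.pow_pos hn0 : 0 < n ^ k)
    refine le_trans (le_of_eq ?_) ((Nat.pow_le_pow_left hsum' (k + 1)).trans h)
    rw [mul_pow]
    ring
  have hdesc : ∀ v, (d v - s) ^ s ≤ #{e : Fin s ↪ Fin (B * s) | ∀ i, R (e i) v} := by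
    intro v
    calc (d v - s) ^ s ≤ (d v + 1 - s) ^ s := Nat.pow_le_pow_left (by omega) _
      _ ≤ (d v).descFactorial s := Nat.pow_sub_le_descFactorial _ _
      _ = Fintype.card (Fin s ↪ {i // R i v}) := by
        rw [Fintype.card_embedding_eq, Fintype.card_fin, Fintype.card_subtype]
      _ ≤ _ := by
        rw [← card_univ]
        refine card_le_card_of_injOn (fun e => e.trans (Function.Embedding.subtype _)) ?_ ?_
        · intro e _
          simpa using fun i => (e i).2
        · intro e _ e' _ h
          ext i
          exact congrArg Fin.val (DFunLike.congr_fun h i)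
  have hswap : ∑ v, #{e : Fin s ↪ Fin (B * s) | ∀ i, R (e i) v}
      = ∑ e : Fin s ↪ Fin (B * s), #{v | ∀ i, R (e i) v} := by
    simp only [card_filter]
    exact sum_comm
  have htot : s ^ s * n ≤ ∑ e : Fin s ↪ Fin (B * s), #{v | ∀ i, R (e i) v} :=
    hpow.trans ((sum_le_sum fun v _ => hdesc v).trans hswap.le)
  have hne : (univ : Finset (Fin s ↪ Fin (B * s))).Nonempty := by
    rw [univ_nonempty_iff]
    exact ⟨Fin.castLEEmb (Nat.le_mul_of_pos_left s hB)⟩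
  have hlt := sum_lt_sum_of_nonempty hne fun e _ => hcon e
  rw [← sum_mul] at hlt
  simp only [sum_const, card_univ, smul_eq_mul, Fintype.card_embedding_eq, Fintype.card_fin]
    at hlt
  have hle : (B * s).descFactorial s ≤ B ^ s * s ^ s := by
    rw [← mul_pow]
    exact Nat.descFactorial_le_pow _ _
  have h3 := Nat.mul_le_mul_right (B ^ s) htot
  have h4 := Nat.mul_le_mul_right n hle
  linarith

open Finset in
/-- Among the many `(k + 2)`-tuples in `M`, many `(k + 1)`-tuples have many extensions. -/
theorem card_tuples_with_many_extensions {V : Type*} [Fintype V] [Nonempty V] [DecidableEq V]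
    (B k : ℕ) (M : Finset (Fin (k + 2) → V))
    (hM : (k + 2) * 2 * Fintype.card V ^ (k + 2) < B * #M) :
    (k + 1) * 2 * Fintype.card V ^ (k + 1) <
      B * #{g : Fin (k + 1) → V |
        2 * Fintype.card V < B * #{v | (Fin.snoc g v : Fin (k + 2) → V) ∈ M}} := by
  set n := Fintype.card V with hn
  have hn0 : 0 < n := Fintype.card_pos
  let ext : (Fin (k + 1) → V) → ℕ := fun g => #{v | (Fin.snoc g v : Fin (k + 2) → V) ∈ M}
  have hMsum : #M = ∑ g, ext g := by
    have h := card_eq_sum_card_fiberwise (s := M) (t := univ)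
      (f := fun f : Fin (k + 2) → V => (Fin.init f : Fin (k + 1) → V)) (by simp)
    rw [h]
    refine sum_congr rfl fun g _ => ?_
    refine card_bij' (fun f _ => f (Fin.last _)) (fun v _ => Fin.snoc g v) ?_ ?_ ?_ ?_
    · intro f hf
      obtain ⟨hf, rfl⟩ := mem_filter.1 hf
      simpa using hf
    · intro v hv
      simpa using hv
    · intro f hf
      obtain ⟨hf, rfl⟩ := mem_filter.1 hf
      simp
    · intro v hv
      simp
  have hbound : ∀ g, B * ext g ≤ (if 2 * n < B * ext g then B * n else 0) + 2 * n := by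
    intro g
    split_ifs with h
    · exact (Nat.mul_le_mul_left B (card_le_univ _)).trans (Nat.le_add_right _ _)
    · omega
  have h := sum_le_sum fun g (_ : g ∈ univ) => hbound g
  rw [← mul_sum, ← hMsum, sum_add_distrib, ← sum_filter] at h
  simp only [sum_const, smul_eq_mul, card_univ, Fintype.card_pi, prod_const,
    Fintype.card_fin, ← hn] at h
  refine Nat.lt_of_mul_lt_mul_right (a := n) ?_
  change _ < B * #{g | 2 * n < B * ext g} * n
  have e1 : n ^ (k + 2) = n ^ (k + 1) * n := pow_succ _ _
  rw [e1] at hM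
  nlinarith

open Finset in
/-- A dense family `M` of injective `(k + 1)`-tuples in `G` satisfying the adjacencies `E`
contains all the tuples obtained from `s` disjoint `k`-tuples and the vertices of a large set `T`,
where the `k`-tuples span a blow-up. -/
theorem exists_disjoint_tuples_of_dense {V : Type*} [Fintype V] [Nonempty V] [DecidableEq V]
    (G : SimpleGraph V) (B : ℕ) (hB : 2 ≤ B) (k : ℕ) :
    ∀ (E : Fin (k + 1) → Fin (k + 1) → Prop) (M : Finset (Fin (k + 1) → V)),
      (∀ f ∈ M, Function.Injective f ∧ ∀ a b, E a b → G.Adj (f a) (f b)) →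
      (k + 1) * 2 * Fintype.card V ^ (k + 1) < B * #M →
      ∀ s, 1 ≤ s → (∀ j, k = j + 1 → B ^ (3 * (s * B ^ j)) ≤ Fintype.card V) →
      ∃ (x : Fin s → Fin k → V) (T : Finset V),
        Fintype.card V ≤ #T * B ^ (if k = 0 then 1 else s) ∧
        (∀ i j a b, x i a = x j b → i = j ∧ a = b) ∧
        (∀ i, ∀ v ∈ T, (Fin.snoc (x i) v : Fin (k + 1) → V) ∈ M) ∧
        (∀ i j a b, E (Fin.castSucc a) (Fin.castSucc b) → G.Adj (x i a) (x j b)) := by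
  induction k with
  | zero =>
    intro E M _ hM s _ _
    refine ⟨fun _ a => a.elim0, M.image fun f => f 0, ?_, fun _ _ a => a.elim0, ?_,
      fun _ _ a => a.elim0⟩
    · rw [card_image_of_injective]
      · simp at hM ⊢
        linarith
      · intro f g h
        ext i
        rw [Fin.fin_one_eq_zero i]
        exact h
    · intro i v hv
      obtain ⟨f, hf, rfl⟩ := mem_image.1 hv
      convert hf
      ext a
      rw [Fin.fin_one_eq_zero a]
      rfl
  | succ k ih =>
    intro E M hE hM s hs hn
    have hcond := hn k rfl
    set M' : Finset (Fin (k + 1) → V) := {g : Fin (k + 1) → V |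
        2 * Fintype.card V < B * #{v | (Fin.snoc g v : Fin (k + 2) → V) ∈ M}} with hM'
    have hM'card := card_tuples_with_many_extensions B k M (by simpa [add_assoc] using hM)
    have hM'E : ∀ g ∈ M', Function.Injective g ∧
        ∀ a b, E (Fin.castSucc a) (Fin.castSucc b) → G.Adj (g a) (g b) := by
      intro g hg
      have hpos : 0 < #{v | (Fin.snoc g v : Fin (k + 2) → V) ∈ M} := by
        rw [hM', mem_filter] at hg
        by_contra h0
        simp only [not_lt, nonpos_iff_eq_zero] at h0
        rw [h0] at hg
        omega
      obtain ⟨v, hv⟩ := card_pos.1 hpos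
      obtain ⟨hinj, hadj⟩ := hE _ (mem_filter.1 hv).2
      refine ⟨fun a b hab => ?_, fun a b hab => ?_⟩
      · exact Fin.castSucc_injective _ (hinj (by simpa using hab))
      · simpa using hadj _ _ hab
    have hBs : s ≤ B ^ s := (Nat.lt_pow_self (by omega)).le
    have hBs1 : 1 ≤ B * s := Nat.mul_pos (by omega) hs
    obtain ⟨x, T, hT, hx, hxM, hxG⟩ := ih (fun a b => E a.castSucc b.castSucc) M' hM'E hM'card
      (B * s) hBs1 (by
        rintro j rfl
        refine le_trans (le_of_eq ?_) hcond
        ring)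
    have hTcard : B * s ≤ #T := by
      refine Nat.le_of_mul_le_mul_right (hT.trans' (hcond.trans' ?_))
        (Nat.pow_pos (by omega : 0 < B))
      split_ifs with hk
      · subst hk
        calc B * s * B ^ 1 = B ^ 2 * s := by ring
          _ ≤ B ^ 2 * B ^ s := Nat.mul_le_mul_left _ hBs
          _ = B ^ (2 + s) := (pow_add _ _ _).symm
          _ ≤ _ := Nat.pow_le_pow_right (by omega) (by simp; omega)
      · calc B * s * B ^ (B * s) ≤ B ^ (B * s) * B ^ (B * s) :=
              Nat.mul_le_mul_right _ (Nat.lt_pow_self (by omega)).le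
          _ = B ^ (B * s + B * s) := (pow_add _ _ _).symm
          _ ≤ _ := by
            refine Nat.pow_le_pow_right (by omega) ?_
            have : B * s ≤ s * B ^ k := by
              rw [mul_comm]
              exact Nat.mul_le_mul_left _ (Nat.le_self_pow hk B)
            omega
    obtain ⟨w⟩ : Nonempty (Fin (B * s) ↪ T) :=
      Function.Embedding.nonempty_of_card_le (by simpa using hTcard)
    let y : Fin (B * s) → Fin (k + 1) → V := fun i => Fin.snoc (x i) (w i : V)
    have hcross : ∀ i j, (Fin.snoc (x i) (w j : V) : Fin (k + 1) → V) ∈ M' :=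
      fun i j => hxM i _ (w j).2
    have hne : ∀ i j a, x i a ≠ w j := by
      intro i j a h
      have := (hM'E _ (hcross i j)).1 (a₁ := a.castSucc) (a₂ := Fin.last _) (by simpa using h)
      exact Fin.castSucc_ne_last a this
    obtain ⟨e, he⟩ := exists_embedding_large_common_neighbors B s hs
      (fun i v => (Fin.snoc (y i) v : Fin (k + 2) → V) ∈ M)
      (fun i => (mem_filter.1 (hcross i i)).2.le) (by omega)
    refine ⟨fun i => y (e i),
      univ.filter fun v => ∀ i, (Fin.snoc (y (e i)) v : Fin (k + 2) → V) ∈ M,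
      by simpa using he, ?_, fun i v hv => (mem_filter.1 hv).2 i, ?_⟩
    · intro i j a b
      refine Fin.lastCases ?_ (fun a => ?_) a <;> refine Fin.lastCases ?_ (fun b => ?_) b <;>
        simp only [y, Fin.snoc_last, Fin.snoc_castSucc]
      · intro h
        exact ⟨e.injective (w.injective (Subtype.ext h)), trivial⟩
      · intro h
        exact (hne _ _ _ h.symm).elim
      · intro h
        exact (hne _ _ _ h).elim
      · intro h
        obtain ⟨h1, rfl⟩ := hx _ _ _ _ h
        exact ⟨e.injective h1, rfl⟩
    · intro i j a b
      refine Fin.lastCases ?_ (fun a => ?_) a <;> refine Fin.lastCases ?_ (fun b => ?_) b <;>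
        simp only [y, Fin.snoc_last, Fin.snoc_castSucc] <;> intro h
      · exact absurd ((hM'E _ (hcross (e i) (e i))).2 _ _ h) (G.loopless.irrefl _)
      · simpa using (hM'E _ (hcross (e j) (e i))).2 _ _ h
      · simpa using (hM'E _ (hcross (e i) (e j))).2 _ _ h
      · exact hxG _ _ _ _ h

/-- Numerical bounds for the reciprocal density `B`, an integer near `2 * r / c`. -/
theorem log_mul_pow_bounds (r : ℕ) (hr : 2 ≤ r) (c B : ℝ) (hc0 : 0 < c) (hc1 : c ≤ 1 / 2)
    (hB1 : 2 * r / c ≤ B) (hB2 : B ≤ 3 * r / c) :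
    3 * Real.log B ≤ B ∧ c ^ (r ^ 2) * B ^ (r - 1) ≤ 1 ∧
      c ^ (r ^ 2) * Real.log B < c ^ (r - 1) := by
  have hr' : (2 : ℝ) ≤ r := by exact_mod_cast hr
  have hB8 : 8 ≤ B := by
    refine le_trans ?_ hB1
    rw [le_div_iff₀ hc0]
    linarith
  have hlog : 3 * Real.log B ≤ B := by
    have h1 : Real.log B = 3 * Real.log 2 + Real.log (B / 8) := by
      rw [Real.log_div (by linarith) (by norm_num), show (8 : ℝ) = 2 ^ 3 by norm_num, Real.log_pow]
      push_cast
      ring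
    have h2 := Real.log_le_sub_one_of_pos (show 0 < B / 8 by linarith)
    have h3 := Real.log_two_lt_d9
    linarith
  have hcB : c * B ≤ 3 * r := by
    rw [le_div_iff₀ hc0] at hB2
    linarith
  obtain ⟨k, rfl⟩ : ∃ k, r = k + 2 := ⟨r - 2, by omega⟩
  have hcp : ∀ m : ℕ, c ^ m ≤ (1 / 2) ^ m := fun m => pow_le_pow_left₀ hc0.le hc1 m
  refine ⟨hlog, ?_, ?_⟩
  · have e : c ^ ((k + 2) ^ 2) * B ^ (k + 2 - 1) = c * (c ^ (k + 2) * (c * B)) ^ (k + 1) := by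
      rw [show k + 2 - 1 = k + 1 by omega, mul_pow, mul_pow, ← pow_mul]
      ring
    have hle : c ^ (k + 2) * (c * B) ≤ (1 / 2) ^ (k + 2) * (3 * ((k + 2 : ℕ) : ℝ)) :=
      mul_le_mul (hcp _) hcB (by positivity) (by positivity)
    rw [e]
    refine (mul_le_mul hc1 (pow_le_pow_left₀ (by positivity) hle _) (by positivity)
      (by norm_num)).trans ?_
    rcases k with _ | _ | k
    · norm_num
    · norm_num
    · have h : ∀ j : ℕ, 3 * (j + 4) ≤ 2 ^ (j + 4) := by
        intro j
        induction j with
        | zero => norm_num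
        | succ j ih => rw [show j + 1 + 4 = j + 4 + 1 by ring, pow_succ]; omega
      have h1 : ((1 : ℝ) / 2) ^ (k + 4) * (3 * ((k + 4 : ℕ) : ℝ)) ≤ 1 := by
        rw [one_div, inv_pow, inv_mul_le_iff₀ (by positivity), mul_one]
        exact_mod_cast h k
      have h2 := pow_le_one₀ (n := k + 1 + 1 + 1) (by positivity) h1
      linarith
  · have h1 : c * Real.log B ≤ (k + 2 : ℕ) := by nlinarith
    have h2 : c ^ (k + 2) * ((k + 2 : ℕ) : ℝ) < 1 := by
      have h3 : ((k + 2 : ℕ) : ℝ) < 2 ^ (k + 2) := by exact_mod_cast Nat.lt_two_pow_self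
      calc c ^ (k + 2) * ((k + 2 : ℕ) : ℝ) < c ^ (k + 2) * 2 ^ (k + 2) := by gcongr
        _ = (c * 2) ^ (k + 2) := (mul_pow _ _ _).symm
        _ ≤ 1 := pow_le_one₀ (by positivity) (by linarith)
    have hck : c ^ ((k + 2) ^ 2) ≤ c ^ (k + 1) * c ^ (k + 2) * c := by
      rw [← pow_add, ← pow_succ]
      exact pow_le_pow_of_le_one hc0.le (by linarith) (by nlinarith)
    have hl0 : 0 ≤ Real.log B := Real.log_nonneg (by linarith)
    rw [show k + 2 - 1 = k + 1 by omega]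
    calc c ^ ((k + 2) ^ 2) * Real.log B ≤ c ^ (k + 1) * c ^ (k + 2) * c * Real.log B := by gcongr
      _ = c ^ (k + 1) * (c ^ (k + 2) * (c * Real.log B)) := by ring
      _ ≤ c ^ (k + 1) * (c ^ (k + 2) * (k + 2 : ℕ)) := by gcongr
      _ < c ^ (k + 1) * 1 := by gcongr
      _ = c ^ (k + 1) := mul_one _

/-- Theorem 1: if a graph `G` of order `n` contains more than `c·n^r` copies of a graph `H`
of order `r` (counted as injections preserving edges), then `G` contains the blow-up
`H(s,…,s,t)` with `s = ⌊c^(r²) ln n⌋` and `t > n^(1-c^(r-1))`. -/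
theorem stmt_14 {V : Type*} [Fintype V] [DecidableEq V]
    (G : SimpleGraph V) (n : ℕ) (hn : Fintype.card V = n) (hn2 : 2 ≤ n)
    (r : ℕ) (hr : 2 ≤ r) (H : SimpleGraph (Fin r))
    (c : ℝ) (hc0 : 0 < c) (hc1 : c ≤ 1/2)
    (hcopies : (Nat.card {f : Fin r → V // Function.Injective f ∧
        ∀ u v : Fin r, H.Adj u v → G.Adj (f u) (f v)} : ℝ) > c * (n : ℝ) ^ r) :
    ∃ (t : ℕ) (W : Fin r → Finset V),
      (t : ℝ) > (n : ℝ) ^ ((1 : ℝ) - c ^ (r - 1)) ∧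
      (∀ i j : Fin r, i ≠ j → Disjoint (W i) (W j)) ∧
      (∀ i : Fin r, i.val < r - 1 → (W i).card = ⌊c ^ (r ^ 2) * Real.log n⌋₊) ∧
      (∀ i : Fin r, i.val = r - 1 → (W i).card = t) ∧
      (∀ i j : Fin r, H.Adj i j → ∀ u ∈ W i, ∀ v ∈ W j, G.Adj u v) := by
  classical
  have hn1 : (1 : ℝ) < n := by exact_mod_cast hn2
  have hlogn : 0 < Real.log n := Real.log_pos hn1
  set s := ⌊c ^ (r ^ 2) * Real.log n⌋₊
  have hsle : (s : ℝ) ≤ c ^ (r ^ 2) * Real.log n := Nat.floor_le (by positivity)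
  rcases Nat.eq_zero_or_pos s with hs0 | hs1
  · refine ⟨n, fun i => if i.val < r - 1 then ∅ else Finset.univ, ?_, ?_, ?_, ?_, ?_⟩
    · have h := Real.rpow_lt_rpow_of_exponent_lt hn1
        (show (1 : ℝ) - c ^ (r - 1) < 1 by linarith [pow_pos hc0 (r - 1)])
      rwa [Real.rpow_one] at h
    · intro i j hij
      have : i.val ≠ j.val := fun h => hij (Fin.ext h)
      have := i.isLt
      have := j.isLt
      by_cases hi : i.val < r - 1
      · simp [hi]
      · have hj : j.val < r - 1 := by omega
        simp [hj]
    · intro i hi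
      simp [hi, hs0]
    · intro i hi
      simp [hi, hn]
    · intro i j hij u hu v hv
      have : i.val ≠ j.val := fun h => hij.ne (Fin.ext h)
      have := i.isLt
      have := j.isLt
      by_cases hi : i.val < r - 1
      · simp [hi] at hu
      · have hj : j.val < r - 1 := by omega
        simp [hj] at hv
  obtain ⟨k, rfl⟩ : ∃ k, r = k + 1 := ⟨r - 1, by omega⟩
  have hV : Nonempty V := Fintype.card_pos_iff.1 (by omega)
  have hr' : (2 : ℝ) ≤ ((k + 1 : ℕ) : ℝ) := by exact_mod_cast hr
  set B := ⌈2 * ((k + 1 : ℕ) : ℝ) / c⌉₊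
  have hB1 : 2 * ((k + 1 : ℕ) : ℝ) / c ≤ B := Nat.le_ceil _
  have hB2 : (B : ℝ) ≤ 3 * ((k + 1 : ℕ) : ℝ) / c := by
    refine (Nat.ceil_lt_add_one (by positivity)).le.trans ?_
    rw [div_add_one hc0.ne']
    gcongr
    linarith
  obtain ⟨hlogB, hpowB, hlogB'⟩ := log_mul_pow_bounds (k + 1) hr c B hc0 hc1 hB1 hB2
  have hB8 : (2 : ℝ) ≤ B := by
    refine le_trans ?_ hB1
    rw [le_div_iff₀ hc0]
    linarith
  have hB0 : (0 : ℝ) < B := by linarith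
  let M : Finset (Fin (k + 1) → V) := Finset.univ.filter fun f =>
    Function.Injective f ∧ ∀ u v, H.Adj u v → G.Adj (f u) (f v)
  have hMcard : c * (n : ℝ) ^ (k + 1) < M.card := by
    rwa [Nat.card_eq_fintype_card, Fintype.card_subtype] at hcopies
  obtain ⟨x, T, hT, hx, hxM, hxG⟩ := exists_disjoint_tuples_of_dense G B (by exact_mod_cast hB8) k
    H.Adj M (fun f hf => (Finset.mem_filter.1 hf).2) (by
      rw [hn]
      have h1 : ((k + 1 : ℕ) : ℝ) * 2 * n ^ (k + 1) < B * M.card := by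
        have h2 : 2 * ((k + 1 : ℕ) : ℝ) ≤ B * c := (div_le_iff₀ hc0).1 hB1
        have h3 : (0 : ℝ) ≤ (n : ℝ) ^ (k + 1) := by positivity
        nlinarith
      exact_mod_cast h1) s hs1 (by
      rintro j rfl
      rw [hn]
      have h1 : (B : ℝ) ^ (3 * (s * B ^ j)) ≤ n := by
        rw [← Real.log_le_log_iff (by positivity) (by linarith), Real.log_pow]
        push_cast
        calc 3 * (s * (B : ℝ) ^ j) * Real.log B = s * (B : ℝ) ^ j * (3 * Real.log B) := by ring
          _ ≤ s * (B : ℝ) ^ j * B := by gcongr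
          _ = s * (B : ℝ) ^ (j + 1) := by ring
          _ ≤ (c ^ ((j + 1 + 1) ^ 2) * Real.log n) * (B : ℝ) ^ (j + 1) := by gcongr
          _ = (c ^ ((j + 1 + 1) ^ 2) * (B : ℝ) ^ (j + 1)) * Real.log n := by ring
          _ ≤ 1 * Real.log n := by gcongr; exact hpowB
          _ = Real.log n := one_mul _
      exact_mod_cast h1)
  rw [if_neg (by omega), hn] at hT
  have hTM : ∀ i, ∀ v ∈ T, Function.Injective (Fin.snoc (x i) v : Fin (k + 1) → V) ∧
      ∀ a b, H.Adj a b → G.Adj ((Fin.snoc (x i) v : Fin (k + 1) → V) a)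
        ((Fin.snoc (x i) v : Fin (k + 1) → V) b) :=
    fun i v hv => (Finset.mem_filter.1 (hxM i v hv)).2
  have hxT : ∀ i a, x i a ∉ T := by
    intro i a h
    have := (hTM i _ h).1 (a₁ := a.castSucc) (a₂ := Fin.last _) (by simp)
    exact Fin.castSucc_ne_last a this
  let W : Fin (k + 1) → Finset V :=
    Fin.snoc (fun a : Fin k => Finset.univ.image fun i => x i a) T
  have hWl : W (Fin.last k) = T := Fin.snoc_last _ _
  have hWc : ∀ a : Fin k, W a.castSucc = Finset.univ.image fun i => x i a :=
    fun a => Fin.snoc_castSucc _ _ _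
  refine ⟨T.card, W, ?_, ?_, ?_, ?_, ?_⟩
  · have h1 : (n : ℝ) ≤ T.card * (B : ℝ) ^ s := by exact_mod_cast hT
    have h2 : (B : ℝ) ^ s < (n : ℝ) ^ (c ^ (k + 1 - 1)) := by
      rw [← Real.log_lt_log_iff (by positivity) (by positivity), Real.log_pow,
        Real.log_rpow (by linarith)]
      have hl : 0 ≤ Real.log B := Real.log_nonneg (by linarith)
      calc s * Real.log B ≤ c ^ ((k + 1) ^ 2) * Real.log n * Real.log B := by gcongr
        _ = c ^ ((k + 1) ^ 2) * Real.log B * Real.log n := by ring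
        _ < _ := by gcongr
    rw [Real.rpow_sub (by linarith), Real.rpow_one, gt_iff_lt, div_lt_iff₀ (by positivity)]
    have hT0 : (0 : ℝ) < T.card := by
      by_contra h0
      have : (T.card : ℝ) = 0 := le_antisymm (not_lt.1 h0) (by positivity)
      rw [this] at h1
      linarith
    exact h1.trans_lt (by gcongr)
  · intro a b
    refine Fin.lastCases ?_ (fun a => ?_) a <;> refine Fin.lastCases ?_ (fun b => ?_) b <;>
      intro hab <;> rw [Finset.disjoint_left] <;> simp only [hWl, hWc, Finset.mem_image,
        Finset.mem_univ, true_and]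
    · exact absurd rfl hab
    · rintro v hv ⟨i, rfl⟩
      exact hxT _ _ hv
    · rintro v ⟨i, rfl⟩ hv
      exact hxT _ _ hv
    · rintro v ⟨i, rfl⟩ ⟨j, h⟩
      exact hab (by rw [(hx _ _ _ _ h).2])
  · intro a
    refine Fin.lastCases ?_ (fun a => ?_) a
    · simp
    · intro _
      rw [hWc, Finset.card_image_of_injective _ fun i j h => (hx _ _ _ _ h).1]
      simp
  · intro a ha
    rw [show a = Fin.last k from Fin.ext (by simpa using ha), hWl]
  · intro a b
    refine Fin.lastCases ?_ (fun a => ?_) a <;> refine Fin.lastCases ?_ (fun b => ?_) b <;>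
      intro hab <;> simp only [hWl, hWc, Finset.mem_image, Finset.mem_univ, true_and]
    · exact absurd hab (H.loopless.irrefl _)
    · rintro u hu v ⟨i, rfl⟩
      simpa using (hTM i u hu).2 _ _ hab
    · rintro u ⟨i, rfl⟩ v hv
      simpa using (hTM i v hv).2 _ _ hab
    · rintro u ⟨i, rfl⟩ v ⟨j, rfl⟩
      exact hxG _ _ _ _ hab
end

section
/- Let r ≥ 2 be an integer, 0 < c ≤ 1/2 real, H a graph of order r, and G a graph of order n ≥ 2. If there are more than c·n^r induced embeddings of H into G, then G contains an induced subgraph of type H(s, ..., s, t), where s = ⌊c^{r²} ln n⌋ and t > n^{1 − c^{r-1}}. -/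
/-- A family of tuples of `M`, injective in every coordinate, such that any two entries in distinct
coordinates (possibly of different tuples of the family) are jointly extended by a tuple of `M`. -/
def IsTupleGrid {V : Type*} {r s : ℕ} (M : Finset (Fin r → V)) (y : Fin s → Fin r → V) : Prop :=
  (∀ k, y k ∈ M) ∧ (∀ i, Function.Injective fun k => y k i) ∧
    ∀ i j, i ≠ j → ∀ k l, ∃ f ∈ M, f i = y k i ∧ f j = y l j

theorem IsTupleGrid.comp {V : Type*} {r s s' : ℕ} {M : Finset (Fin r → V)}
    {y : Fin s → Fin r → V} (h : IsTupleGrid M y) {e : Fin s' → Fin s}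
    (he : Function.Injective e) : IsTupleGrid M (y ∘ e) :=
  ⟨fun k => h.1 (e k), fun i => (h.2.1 i).comp he, fun i j hij k l => h.2.2 i j hij (e k) (e l)⟩

/-- The coefficient of `log n` in the guaranteed size of a tuple grid. -/
noncomputable def gridRate (r : ℕ) (c : ℝ) : ℝ := if r = 1 then 2 * c else c ^ (r ^ 2)

/-- Among `S` sets of density at least `δ`, some `s` have a large common intersection. -/
theorem exists_common_subset {V : Type*} [Fintype V] [DecidableEq V] [Nonempty V] {S s : ℕ}
    {δ : ℝ} (hs : s < δ * S) (D : Fin S → Finset V)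
    (hD : ∀ k, δ * Fintype.card V ≤ (D k).card) :
    ∃ (T : Finset (Fin S)) (X : Finset V), T.card = s ∧ (∀ k ∈ T, X ⊆ D k) ∧
      (δ * S - s) * Fintype.card V ≤ S * 2 ^ S * X.card := by
  classical
  let N : V → Finset (Fin S) := fun x => Finset.univ.filter fun k => x ∈ D k
  let A : Finset V := Finset.univ.filter fun x => s ≤ (N x).card
  have hn : (0 : ℝ) < Fintype.card V := by exact_mod_cast Fintype.card_pos
  have hsum : ∑ x, ((N x).card : ℝ) = ∑ k, ((D k).card : ℝ) := by
    have := Finset.sum_card_bipartiteAbove_eq_sum_card_bipartiteBelow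
      (s := (Finset.univ : Finset V)) (t := (Finset.univ : Finset (Fin S))) fun x k => x ∈ D k
    simp only [Finset.bipartiteAbove, Finset.bipartiteBelow, Finset.filter_univ_mem] at this
    exact_mod_cast this
  have hlow : S * (δ * Fintype.card V) ≤ ∑ k, ((D k).card : ℝ) := by
    have := Finset.sum_le_sum fun k (_ : k ∈ Finset.univ) => hD k
    simpa using this
  have hup : ∑ x, ((N x).card : ℝ) ≤ A.card * S + Fintype.card V * s := by
    have : ∀ x, ((N x).card : ℝ) ≤ (if x ∈ A then (S : ℝ) else 0) + s := by
      intro x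
      by_cases hx : x ∈ A
      · have : (N x).card ≤ S := (Finset.card_le_univ _).trans (by simp)
        have : ((N x).card : ℝ) ≤ S := by exact_mod_cast this
        rw [if_pos hx]
        linarith [(Nat.cast_nonneg s : (0 : ℝ) ≤ s)]
      · have : (N x).card ≤ s := by
          simp only [A, Finset.mem_filter, Finset.mem_univ, true_and, not_le] at hx
          exact hx.le
        simpa [hx] using this
    refine (Finset.sum_le_sum fun x _ => this x).trans ?_
    simp [Finset.sum_add_distrib]
  have hA : A.Nonempty := by
    by_contra hA
    rw [Finset.not_nonempty_iff_eq_empty] at hA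
    simp only [hA, Finset.card_empty, Nat.cast_zero, zero_mul, zero_add] at hup
    nlinarith
  have hch : ∀ x, ∃ T : Finset (Fin S), x ∈ A → T ⊆ N x ∧ T.card = s := by
    intro x
    by_cases hx : x ∈ A
    · obtain ⟨T, hT⟩ := Finset.exists_subset_card_eq (Finset.mem_filter.1 hx).2
      exact ⟨T, fun _ => hT⟩
    · exact ⟨∅, fun h => absurd h hx⟩
  choose τ hτ using hch
  obtain ⟨T, hTmem, hT⟩ := Finset.exists_max_image (A.image τ)
    (fun T => (A.filter fun x => τ x = T).card) (hA.image τ)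
  obtain ⟨x₀, hx₀, rfl⟩ := Finset.mem_image.1 hTmem
  refine ⟨τ x₀, A.filter fun x => τ x = τ x₀, (hτ x₀ hx₀).2, ?_, ?_⟩
  · intro k hk x hx
    obtain ⟨hxA, hxT⟩ := Finset.mem_filter.1 hx
    have := (hτ x hxA).1 (hxT ▸ hk)
    simpa [N] using this
  · have h1 : A.card ≤ (A.filter fun x => τ x = τ x₀).card * (A.image τ).card :=
      Finset.card_le_mul_card_image A _ fun T hTm => hT T hTm
    have h2 : (A.image τ).card ≤ 2 ^ S := (Finset.card_le_univ _).trans (by simp)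
    have h3 : (A.card : ℝ) ≤ (A.filter fun x => τ x = τ x₀).card * 2 ^ S := by
      exact_mod_cast h1.trans (Nat.mul_le_mul_left _ h2)
    have h4 := mul_le_mul_of_nonneg_right h3 (Nat.cast_nonneg S : (0 : ℝ) ≤ S)
    linarith

/-- A dense set of `(r + 1)`-tuples has many initial `r`-tuples with many extensions. -/
theorem lt_card_filter_extensions {V : Type*} [Fintype V] [DecidableEq V] [Nonempty V] {r : ℕ}
    {c δ : ℝ} (hδ : 0 ≤ δ) (M : Finset (Fin (r + 1) → V))
    (hM : c * (Fintype.card V : ℝ) ^ (r + 1) < M.card) :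
    (c - δ) * (Fintype.card V : ℝ) ^ r <
      (Finset.univ.filter fun g : Fin r → V => δ * Fintype.card V ≤
        ((Finset.univ.filter fun x => (Fin.snoc g x : Fin (r + 1) → V) ∈ M).card : ℝ)).card := by
  classical
  set D : (Fin r → V) → Finset V := fun g =>
    Finset.univ.filter fun x => (Fin.snoc g x : Fin (r + 1) → V) ∈ M
  set A := Finset.univ.filter fun g : Fin r → V => δ * Fintype.card V ≤ ((D g).card : ℝ)
  have hn : (0 : ℝ) < Fintype.card V := by exact_mod_cast Fintype.card_pos
  have hsum : M.card = ∑ g, (D g).card := by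
    rw [← Finset.card_sigma]
    refine Finset.card_bij' (fun f _ => ⟨Fin.init f, f (Fin.last r)⟩)
      (fun p _ => Fin.snoc p.1 p.2) ?_ ?_ ?_ ?_
    · intro f hf
      simpa [D, Fin.snoc_init_self] using hf
    · intro p hp
      simpa [D] using hp
    · intro f _
      exact Fin.snoc_init_self f
    · intro p _
      simp
  have hup : (M.card : ℝ) ≤ A.card * Fintype.card V +
      (Fintype.card V : ℝ) ^ r * (δ * Fintype.card V) := by
    have : ∀ g, ((D g).card : ℝ) ≤
        (if g ∈ A then (Fintype.card V : ℝ) else 0) + δ * Fintype.card V := by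
      intro g
      by_cases hg : g ∈ A
      · have : ((D g).card : ℝ) ≤ Fintype.card V := by exact_mod_cast Finset.card_le_univ _
        rw [if_pos hg]
        have := mul_nonneg hδ hn.le
        linarith
      · have : ((D g).card : ℝ) ≤ δ * Fintype.card V := by
          simp only [A, Finset.mem_filter, Finset.mem_univ, true_and, not_le] at hg
          exact hg.le
        simpa [hg] using this
    rw [hsum, Nat.cast_sum]
    refine (Finset.sum_le_sum fun g _ => this g).trans ?_
    simp [Finset.sum_add_distrib]
  refine lt_of_mul_lt_mul_right ?_ hn.le
  rw [pow_succ] at hM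
  linarith

theorem five_quarters_mul_pow_le {r : ℕ} (hr : 2 ≤ r) {c : ℝ} (hc0 : 0 < c) (hc1 : c ≤ 1 / 2) :
    5 / 4 * c ^ r ≤ (1 - c ^ r) ^ (r ^ 2) := by
  have hcr : c ^ r ≤ (1 / 2) ^ r := pow_le_pow_left₀ hc0.le hc1 r
  have hhalf : (1 / 2 : ℝ) ^ r ≤ 1 := pow_le_one₀ (by norm_num) (by norm_num)
  have hmono : (1 - (1 / 2 : ℝ) ^ r) ^ (r ^ 2) ≤ (1 - c ^ r) ^ (r ^ 2) :=
    pow_le_pow_left₀ (by linarith) (by linarith) _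
  suffices h : 5 / 4 * (1 / 2 : ℝ) ^ r ≤ (1 - (1 / 2 : ℝ) ^ r) ^ (r ^ 2) by linarith
  obtain rfl | rfl | hr4 : r = 2 ∨ r = 3 ∨ 4 ≤ r := by omega
  · norm_num
  · norm_num
  obtain ⟨m, rfl⟩ : ∃ m, r = m + 1 := ⟨r - 1, by omega⟩
  have hexp : (m + 1) ^ 2 ≤ 2 ^ m * m := by
    have h8 : 8 ≤ 2 ^ m := by
      calc 8 = 2 ^ 3 := by norm_num
        _ ≤ 2 ^ m := Nat.pow_le_pow_right (by norm_num) (by omega)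
    have h2 : 2 * m + 2 ≤ 2 ^ m := by
      clear * - hr4
      obtain ⟨k, rfl⟩ : ∃ k, m = k + 3 := ⟨m - 3, by omega⟩
      induction k with
      | zero => norm_num
      | succ k ih =>
        have := ih (by omega)
        rw [show k + 1 + 3 = k + 3 + 1 by ring, pow_succ]
        omega
    nlinarith
  have hbern : (1 / 2 : ℝ) ≤ (1 - (1 / 2 : ℝ) ^ (m + 1)) ^ 2 ^ m := by
    have := one_add_mul_le_pow (a := -(1 / 2 : ℝ) ^ (m + 1)) (by linarith) (2 ^ m)
    have h2 : (2 : ℝ) ^ m * (1 / 2) ^ (m + 1) = 1 / 2 := by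
      rw [pow_succ, ← mul_assoc, ← mul_pow]; norm_num
    push_cast at this
    rw [← sub_eq_add_neg] at this
    linarith
  calc 5 / 4 * (1 / 2 : ℝ) ^ (m + 1) ≤ (1 / 2 : ℝ) ^ m := by
        rw [pow_succ]; nlinarith [pow_pos (show (0 : ℝ) < 1 / 2 by norm_num) m]
    _ ≤ ((1 - (1 / 2 : ℝ) ^ (m + 1)) ^ 2 ^ m) ^ m := pow_le_pow_left₀ (by norm_num) hbern m
    _ = (1 - (1 / 2 : ℝ) ^ (m + 1)) ^ (2 ^ m * m) := by rw [pow_mul]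
    _ ≤ _ := pow_le_pow_of_le_one (by linarith)
        (by linarith [pow_pos (show (0 : ℝ) < 1 / 2 by norm_num) (m + 1)]) hexp

/-- The choice of the density threshold in the inductive step. -/
theorem exists_density_threshold {r : ℕ} (hr : 1 ≤ r) {c L : ℝ} (hc0 : 0 < c) (hc1 : c ≤ 1 / 2)
    (hX : 1 ≤ c ^ ((r + 1) ^ 2) * L) :
    ∃ δ : ℝ, 0 < δ ∧ δ < c ∧ 8 ≤ c ^ r * L ∧
      (⌊gridRate r (c - δ) * L⌋₊ : ℝ) ≤ c ^ r * L / 2 ∧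
      c ^ ((r + 1) ^ 2) * L + 1 / 8 ≤ δ * ⌊gridRate r (c - δ) * L⌋₊ := by
  have hL : 0 < L := by
    by_contra! h
    have := mul_nonpos_of_nonneg_of_nonpos (pow_pos hc0 ((r + 1) ^ 2)).le h
    linarith
  have hc3 : c ^ 3 ≤ 1 / 8 := (pow_le_pow_left₀ hc0.le hc1 3).trans (by norm_num)
  have hc2 : c ^ 2 ≤ 1 / 4 := (pow_le_pow_left₀ hc0.le hc1 2).trans (by norm_num)
  have hcc : c ≤ 1 := by linarith
  have h8 : 8 ≤ c ^ r * L := by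
    have h1 : c ^ ((r + 1) ^ 2) ≤ c ^ r * c ^ 3 := by
      rw [← pow_add]
      exact pow_le_pow_of_le_one hc0.le hcc (by nlinarith)
    have h2 := mul_le_mul_of_nonneg_right h1 hL.le
    have h3 := mul_le_mul_of_nonneg_left hc3 (mul_pos (pow_pos hc0 r) hL).le
    nlinarith
  rcases eq_or_lt_of_le hr with rfl | hr2
  · refine ⟨3 / 4 * c, by linarith, by linarith, h8, ?_⟩
    have hg : gridRate 1 (c - 3 / 4 * c) * L = c * L / 2 := by
      rw [gridRate, if_pos rfl]; ring
    rw [hg, pow_one]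
    refine ⟨Nat.floor_le (by positivity), ?_⟩
    have hfl := Nat.lt_floor_add_one (c * L / 2)
    norm_num at hX ⊢
    have h1 : 3 / 4 * c * (c * L / 2 - 1) ≤ 3 / 4 * c * ⌊c * L / 2⌋₊ :=
      mul_le_mul_of_nonneg_left (by linarith) (by linarith)
    have h2 : c ^ 4 * L ≤ 1 / 4 * (c ^ 2 * L) := by
      have := mul_le_mul_of_nonneg_right hc2 (mul_pos (pow_pos hc0 2) hL).le
      nlinarith
    nlinarith
  · have hcr : 0 < c ^ r := pow_pos hc0 r
    have hcr2 : c ^ r ≤ 1 / 4 := (pow_le_pow_of_le_one hc0.le hcc hr2).trans hc2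
    have ha : c - c ^ (r + 1) = c * (1 - c ^ r) := by ring
    refine ⟨c ^ (r + 1), by positivity, by rw [pow_succ]; nlinarith, h8, ?_⟩
    have hg : gridRate r (c - c ^ (r + 1)) = c ^ (r ^ 2) * (1 - c ^ r) ^ (r ^ 2) := by
      rw [gridRate, if_neg (by omega), ha, mul_pow]
    have hpos : 0 ≤ (1 - c ^ r) ^ (r ^ 2) := pow_nonneg (by linarith) _
    have hle : (1 - c ^ r) ^ (r ^ 2) ≤ 1 := pow_le_one₀ (by linarith) (by linarith)
    rw [hg]
    constructor
    · refine (Nat.floor_le (by positivity)).trans ?_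
      have h1 : c ^ (r ^ 2) ≤ c ^ r * c ^ 2 := by
        rw [← pow_add]
        exact pow_le_pow_of_le_one hc0.le hcc (by nlinarith)
      have h2 : c ^ (r ^ 2) * (1 - c ^ r) ^ (r ^ 2) ≤ c ^ r / 2 := by
        have h3 := mul_le_mul_of_nonneg_left hle (pow_pos hc0 (r ^ 2)).le
        nlinarith
      have := mul_le_mul_of_nonneg_right h2 hL.le
      linarith
    · have hfl := Nat.lt_floor_add_one (c ^ (r ^ 2) * (1 - c ^ r) ^ (r ^ 2) * L)
      have h1 : c ^ (r + 1) * (c ^ (r ^ 2) * (1 - c ^ r) ^ (r ^ 2) * L - 1) ≤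
          c ^ (r + 1) * ⌊c ^ (r ^ 2) * (1 - c ^ r) ^ (r ^ 2) * L⌋₊ :=
        mul_le_mul_of_nonneg_left (by linarith) (by positivity)
      have h2 : c ^ (r + 1) * c ^ (r ^ 2) * L * (5 / 4 * c ^ r) ≤
          c ^ (r + 1) * c ^ (r ^ 2) * L * (1 - c ^ r) ^ (r ^ 2) :=
        mul_le_mul_of_nonneg_left (five_quarters_mul_pow_le hr2 hc0 hc1) (by positivity)
      have h3 : c ^ ((r + 1) ^ 2) = c ^ (r + 1) * c ^ (r ^ 2) * c ^ r := by
        rw [← pow_add, ← pow_add]; congr 1; ring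
      have h4 : c ^ (r + 1) ≤ 1 / 8 :=
        (pow_le_pow_of_le_one hc0.le hcc (by omega : 3 ≤ r + 1)).trans hc3
      rw [h3] at hX ⊢
      nlinarith

theorem exp_neg_mul_lt_of_le_mul_two_pow {S : ℕ} {y N x : ℝ} (hy : 8 ≤ y) (hS : (S : ℝ) ≤ y / 2)
    (hN : 0 < N) (h : 1 / 8 * N ≤ S * 2 ^ S * x) : N * Real.exp (-y) < x := by
  have hx : 0 < x := by
    by_contra! hx
    have := mul_nonpos_of_nonneg_of_nonpos (by positivity : (0 : ℝ) ≤ S * 2 ^ S) hx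
    linarith
  have hS2 : 2 * (S : ℝ) ≤ 2 ^ S := by
    clear * -
    have : 2 * S ≤ 2 ^ S := by
      rcases S with _ | S
      · simp
      · have := Nat.lt_two_pow_self (n := S)
        rw [pow_succ]; omega
    exact_mod_cast this
  have hpow : (2 : ℝ) ^ (2 * S + 2) < Real.exp y := by
    rw [← Real.exp_log (show (0 : ℝ) < 2 ^ (2 * S + 2) by positivity), Real.exp_lt_exp,
      Real.log_pow]
    have := Real.log_two_lt_d9
    push_cast
    nlinarith
  have h1 : N ≤ 2 ^ (2 * S + 2) * x := by
    have h2 : 2 * (S : ℝ) * (2 ^ S * x) ≤ 2 ^ S * (2 ^ S * x) :=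
      mul_le_mul_of_nonneg_right hS2 (by positivity)
    have h3 : (2 : ℝ) ^ (2 * S + 2) * x = 4 * (2 ^ S * (2 ^ S * x)) := by
      rw [pow_add, two_mul, pow_add]; ring
    rw [h3]; linarith
  rw [Real.exp_neg, ← div_eq_mul_inv, div_lt_iff₀ (Real.exp_pos y)]
  nlinarith

/-- The inductive step: from grids of `r`-tuples to grids of `r`-tuples with a large common set of
extensions. -/
theorem exists_grid_with_extensions {V : Type*} [Fintype V] [DecidableEq V]
    (hV : 2 ≤ Fintype.card V) {r : ℕ} (hr : 1 ≤ r)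
    (ih : ∀ a : ℝ, 0 < a → a ≤ 1 / 2 → ∀ M : Finset (Fin r → V),
      a * (Fintype.card V : ℝ) ^ r < M.card →
      ∃ y : Fin ⌊gridRate r a * Real.log (Fintype.card V)⌋₊ → Fin r → V, IsTupleGrid M y)
    {c : ℝ} (hc0 : 0 < c) (hc1 : c ≤ 1 / 2) (M : Finset (Fin (r + 1) → V))
    (hM : c * (Fintype.card V : ℝ) ^ (r + 1) < M.card) :
    ∃ (y : Fin ⌊c ^ ((r + 1) ^ 2) * Real.log (Fintype.card V)⌋₊ → Fin r → V) (X : Finset V),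
      (Fintype.card V : ℝ) ^ (1 - c ^ r) < X.card ∧
      (∀ k, ∀ x ∈ X, (Fin.snoc (y k) x : Fin (r + 1) → V) ∈ M) ∧
      (∀ i, Function.Injective fun k => y k i) ∧
      ∀ i j, i ≠ j → ∀ k l, ∃ f ∈ M, f (Fin.castSucc i) = y k i ∧ f (Fin.castSucc j) = y l j := by
  classical
  have hn1 : (1 : ℝ) < Fintype.card V := by exact_mod_cast hV
  have hn : (0 : ℝ) < Fintype.card V := by linarith
  have : Nonempty V := Fintype.card_pos_iff.1 (by omega)
  set L := Real.log (Fintype.card V)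
  have hL : 0 < L := Real.log_pos hn1
  rcases lt_or_ge (c ^ ((r + 1) ^ 2) * L) 1 with hX | hX
  · have h0 : ⌊c ^ ((r + 1) ^ 2) * L⌋₊ = 0 := Nat.floor_eq_zero.2 hX
    rw [h0]
    refine ⟨Fin.elim0, Finset.univ, ?_, fun k => k.elim0, fun i k => k.elim0,
      fun i j _ k => k.elim0⟩
    rw [Finset.card_univ]
    calc (Fintype.card V : ℝ) ^ (1 - c ^ r) < (Fintype.card V : ℝ) ^ (1 : ℝ) :=
          Real.rpow_lt_rpow_of_exponent_lt hn1 (by linarith [pow_pos hc0 r])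
      _ = _ := Real.rpow_one _
  obtain ⟨δ, hδ0, hδc, h8, hS, hδS⟩ := exists_density_threshold hr hc0 hc1 hX
  set S := ⌊gridRate r (c - δ) * L⌋₊
  have hs : (⌊c ^ ((r + 1) ^ 2) * L⌋₊ : ℝ) ≤ c ^ ((r + 1) ^ 2) * L :=
    Nat.floor_le (by positivity)
  set s := ⌊c ^ ((r + 1) ^ 2) * L⌋₊
  obtain ⟨y, hy⟩ := ih (c - δ) (by linarith) (by linarith) _
    (lt_card_filter_extensions hδ0.le M hM)
  have hyD := hy.1
  simp only [Finset.mem_filter, Finset.mem_univ, true_and] at hyD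
  obtain ⟨T, X, hT, hTX, hcard⟩ := exists_common_subset (s := s) (by linarith) _ hyD
  let e : Fin s ↪o Fin S := T.orderEmbOfFin hT
  refine ⟨y ∘ e, X, ?_, ?_, (hy.comp e.injective).2.1, ?_⟩
  · have h1 : 1 / 8 * (Fintype.card V : ℝ) ≤ S * 2 ^ S * X.card :=
      (mul_le_mul_of_nonneg_right (by linarith) hn.le).trans hcard
    have h2 := exp_neg_mul_lt_of_le_mul_two_pow h8 hS hn h1
    rw [Real.rpow_sub hn, Real.rpow_one, Real.rpow_def_of_pos hn, div_eq_mul_inv, ← Real.exp_neg]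
    rwa [mul_comm L]
  · intro k x hx
    have := hTX (e k) (T.orderEmbOfFin_mem hT k) hx
    simpa using this
  · intro i j hij k l
    obtain ⟨g, hg, hgi, hgj⟩ := (hy.comp e.injective).2.2 i j hij k l
    have hpos : 0 < (Finset.univ.filter fun x => (Fin.snoc g x : Fin (r + 1) → V) ∈ M).card := by
      have := (mul_pos hδ0 hn).trans_le (Finset.mem_filter.1 hg).2
      exact_mod_cast this
    obtain ⟨x, hx⟩ := Finset.card_pos.1 hpos
    exact ⟨Fin.snoc g x, (Finset.mem_filter.1 hx).2, by simpa using hgi, by simpa using hgj⟩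

theorem Real.log_le_half {x : ℝ} (hx : 0 < x) : Real.log x ≤ x / 2 := by
  have h := Real.log_le_sub_one_of_pos (half_pos hx)
  rw [Real.log_div hx.ne' two_ne_zero] at h
  linarith [Real.log_two_lt_d9]

theorem exists_isTupleGrid {V : Type*} [Fintype V] [DecidableEq V] (hV : 2 ≤ Fintype.card V)
    {r : ℕ} (hr : 1 ≤ r) {c : ℝ} (hc0 : 0 < c) (hc1 : c ≤ 1 / 2) (M : Finset (Fin r → V))
    (hM : c * (Fintype.card V : ℝ) ^ r < M.card) :
    ∃ y : Fin ⌊gridRate r c * Real.log (Fintype.card V)⌋₊ → Fin r → V, IsTupleGrid M y := by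
  have hn1 : (1 : ℝ) < Fintype.card V := by exact_mod_cast hV
  have hn : (0 : ℝ) < Fintype.card V := by linarith
  have hL : 0 < Real.log (Fintype.card V) := Real.log_pos hn1
  induction r, hr using Nat.le_induction generalizing c with
  | base =>
    have hle : ⌊gridRate 1 c * Real.log (Fintype.card V)⌋₊ ≤ M.card := by
      refine Nat.floor_le_of_le ?_
      rw [gridRate, if_pos rfl]
      rw [pow_one] at hM
      have := mul_le_mul_of_nonneg_left (Real.log_le_half hn) hc0.le
      linarith
    obtain ⟨e⟩ : Nonempty (Fin ⌊gridRate 1 c * Real.log (Fintype.card V)⌋₊ ↪ M) :=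
      Function.Embedding.nonempty_of_card_le (by simpa using hle)
    refine ⟨fun k => (e k : Fin 1 → V), fun k => (e k).2, fun i k l hkl => ?_,
      fun i j hij => absurd (Subsingleton.elim i j) hij⟩
    refine e.injective (Subtype.ext (funext fun j => ?_))
    rw [Subsingleton.elim j i]
    exact hkl
  | succ r hr ih =>
    obtain ⟨y, X, hX, hyX, hinj, hpair⟩ := exists_grid_with_extensions hV hr
      (fun a ha0 ha1 M hM => ih ha0 ha1 M hM) hc0 hc1 M hM
    have hg : gridRate (r + 1) c = c ^ ((r + 1) ^ 2) := by rw [gridRate, if_neg (by omega)]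
    rw [hg]
    have hle : ⌊c ^ ((r + 1) ^ 2) * Real.log (Fintype.card V)⌋₊ ≤ X.card := by
      refine Nat.floor_le_of_le (le_trans ?_ hX.le)
      have h1 : c ^ ((r + 1) ^ 2) ≤ 1 / 2 :=
        (pow_le_of_le_one hc0.le (by linarith) (by positivity)).trans hc1
      have h2 : c ^ r ≤ 1 / 2 := (pow_le_of_le_one hc0.le (by linarith) (by omega)).trans hc1
      rw [Real.rpow_def_of_pos hn]
      have h3 := Real.add_one_le_exp (Real.log (Fintype.card V) * (1 - c ^ r))
      nlinarith
    obtain ⟨e⟩ : Nonempty (Fin ⌊c ^ ((r + 1) ^ 2) * Real.log (Fintype.card V)⌋₊ ↪ X) :=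
      Function.Embedding.nonempty_of_card_le (by simpa using hle)
    refine ⟨fun k => Fin.snoc (y k) (e k : V), fun k => hyX k _ (e k).2, fun i => ?_, ?_⟩
    · induction i using Fin.lastCases with
      | last =>
      simp only [Fin.snoc_last]
      exact Subtype.val_injective.comp e.injective
      | cast i => simpa using hinj i
    · intro i j hij k l
      induction i using Fin.lastCases with
      | last =>
        induction j using Fin.lastCases with
        | last => exact absurd rfl hij
        | cast j => exact ⟨_, hyX l _ (e k).2, by simp, by simp⟩
      | cast i =>
        induction j using Fin.lastCases with
        | last => exact ⟨_, hyX k _ (e l).2, by simp, by simp⟩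
        | cast j => simpa using hpair i j (fun h => hij (h ▸ rfl)) k l


/-- Theorem 2: if a graph `G` of order `n` has more than `c·n^r` induced embeddings of a
graph `H` of order `r`, then `G` contains an induced subgraph of type `H(s,…,s,t)`:
disjoint classes `W i`, with all cross-class adjacencies matching `H`, where the first
`r-1` classes have size `s = ⌊c^(r²) ln n⌋` and the last has size `t > n^(1-c^(r-1))`. -/
theorem stmt_15 {V : Type*} [Fintype V] [DecidableEq V]
    (G : SimpleGraph V) (n : ℕ) (hn : Fintype.card V = n) (hn2 : 2 ≤ n)
    (r : ℕ) (hr : 2 ≤ r) (H : SimpleGraph (Fin r))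
    (c : ℝ) (hc0 : 0 < c) (hc1 : c ≤ 1/2)
    (hcopies : (Nat.card {f : Fin r → V // Function.Injective f ∧
        ∀ u v : Fin r, H.Adj u v ↔ G.Adj (f u) (f v)} : ℝ) > c * (n : ℝ) ^ r) :
    ∃ (t : ℕ) (W : Fin r → Finset V),
      (t : ℝ) > (n : ℝ) ^ ((1 : ℝ) - c ^ (r - 1)) ∧
      (∀ i j : Fin r, i ≠ j → Disjoint (W i) (W j)) ∧
      (∀ i : Fin r, i.val < r - 1 → (W i).card = ⌊c ^ (r ^ 2) * Real.log n⌋₊) ∧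
      (∀ i : Fin r, i.val = r - 1 → (W i).card = t) ∧
      (∀ i j : Fin r, i ≠ j → ∀ u ∈ W i, ∀ v ∈ W j, (G.Adj u v ↔ H.Adj i j)) := by
  classical
  subst hn
  obtain ⟨r, rfl⟩ : ∃ q, r = q + 1 := ⟨r - 1, by omega⟩
  let M : Finset (Fin (r + 1) → V) := Finset.univ.filter fun f => Function.Injective f ∧
    ∀ u v : Fin (r + 1), H.Adj u v ↔ G.Adj (f u) (f v)
  have hM : c * (Fintype.card V : ℝ) ^ (r + 1) < M.card := by
    rwa [Nat.card_eq_fintype_card, Fintype.card_subtype] at hcopies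
  have hMmem : ∀ f ∈ M, Function.Injective f ∧
      ∀ u v : Fin (r + 1), H.Adj u v ↔ G.Adj (f u) (f v) := fun f hf => (Finset.mem_filter.1 hf).2
  obtain ⟨y, X, hX, hyX, hinj, hpair⟩ := exists_grid_with_extensions hn2 (by omega)
    (fun a ha0 ha1 M hM => exists_isTupleGrid hn2 (by omega) ha0 ha1 M hM) hc0 hc1 M hM
  let W : Fin (r + 1) → Finset V :=
    Fin.snoc (α := fun _ => Finset V) (fun i => Finset.univ.image fun k => y k i) X
  have hWl : W (Fin.last r) = X := Fin.snoc_last (α := fun _ => Finset V) _ _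
  have hWc : ∀ i : Fin r, W i.castSucc = Finset.univ.image fun k => y k i :=
    fun i => Fin.snoc_castSucc (α := fun _ => Finset V) _ _ i
  have hW : ∀ i j, i ≠ j → ∀ u ∈ W i, ∀ v ∈ W j, ∃ f ∈ M, f i = u ∧ f j = v := by
    intro i j hij u hu v hv
    induction i using Fin.lastCases with
    | last =>
      induction j using Fin.lastCases with
      | last => exact absurd rfl hij
      | cast j =>
        rw [hWl] at hu
        rw [hWc] at hv
        obtain ⟨l, -, rfl⟩ := Finset.mem_image.1 hv
        exact ⟨_, hyX l u hu, by simp, by simp⟩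
    | cast i =>
      rw [hWc] at hu
      obtain ⟨k, -, rfl⟩ := Finset.mem_image.1 hu
      induction j using Fin.lastCases with
      | last =>
        rw [hWl] at hv
        exact ⟨_, hyX k v hv, by simp, by simp⟩
      | cast j =>
        rw [hWc] at hv
        obtain ⟨l, -, rfl⟩ := Finset.mem_image.1 hv
        exact hpair i j (fun h => hij (h ▸ rfl)) k l
  refine ⟨X.card, W, by simpa using hX, ?_, ?_, ?_, ?_⟩
  · intro i j hij
    rw [Finset.disjoint_left]
    intro u hu hu'
    obtain ⟨f, hf, hi, hj⟩ := hW i j hij u hu u hu'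
    exact hij ((hMmem f hf).1 (hi.trans hj.symm))
  · intro i hi
    induction i using Fin.lastCases with
    | last => simp at hi
    | cast i =>
      rw [hWc, Finset.card_image_of_injective _ (hinj i)]
      simp
  · intro i hi
    obtain rfl : i = Fin.last r := Fin.ext (by simpa using hi)
    rw [hWl]
  · intro i j hij u hu v hv
    obtain ⟨f, hf, rfl, rfl⟩ := hW i j hij u hu v hv
    exact ((hMmem f hf).2 i j).symm
end
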